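/- Let A ∈ ℝ^{I₁×⋯×I_d} admit a nonnegative orthogonal Tucker decomposition with core S ∈ ℝ^{J₁×⋯×J_d} and factors U^(1),…,U^(d). Fix a mode n, a column j of U^(n), a row index t₀ with u^(n)_{t₀,j} ≠ 0, and indices i_m (m ≠ n) such that a_{i₁,…,i_{n−1},t₀,i_{n+1},…,i_d} ≠ 0. For each row t with u^(n)_{t,j} ≠ 0 set α_t = a_{i₁,…,i_{n−1},t,i_{n+1},…,i_d} / a_{i₁,…,i_{n−1},t₀,i_{n+1},…,i_d}. Then for every t with u^(n)_{t,j} ≠ 0, u^(n)_{t,j} = α_t / √(Σ_{t' : u^(n)_{t',j} ≠ 0} α_{t'}²); that is, the entries of the factor matrix U^(n) are given explicitly in terms of entry ratios of A. -/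

import Mathlib

open Matrix
open scoped Classical

/-- A nonnegative matrix with orthonormal columns has at most one nonzero entry in each row. -/
theorem eq_zero_of_nonneg_of_transpose_mul_self_eq_one {m n : Type*} [Fintype m] [DecidableEq n]
    {U : Matrix m n ℝ} (hU : ∀ i j, 0 ≤ U i j) (horth : Uᵀ * U = 1) {t : m} {j j' : n}
    (ht : U t j ≠ 0) (hj : j' ≠ j) : U t j' = 0 := by
  have h : ∑ i, U i j * U i j' = 0 := by
    have h' := congrFun (congrFun horth j) j'
    rwa [Matrix.mul_apply, Matrix.one_apply_ne hj.symm] at h'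
  rw [Finset.sum_eq_zero_iff_of_nonneg fun i _ => mul_nonneg (hU i j) (hU i j')] at h
  exact (mul_eq_zero.mp (h t (Finset.mem_univ t))).resolve_left ht

/-- Summed over the support of a column, the squared entries of a matrix with orthonormal columns
add up to one. -/
theorem sum_sq_support_eq_one {m n : Type*} [Fintype m] [DecidableEq n]
    {U : Matrix m n ℝ} (horth : Uᵀ * U = 1) (j : n) :
    ∑ i ∈ Finset.univ.filter (fun i => U i j ≠ 0), U i j ^ 2 = 1 := by
  have h := congrFun (congrFun horth j) j
  rw [Matrix.mul_apply, Matrix.one_apply_eq] at h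
  rw [← h, Finset.sum_filter]
  refine Finset.sum_congr rfl fun i _ => ?_
  by_cases hi : U i j = 0 <;> simp [hi, sq]

/-- If row `t` of the `n`-th factor is supported in column `j`, the Tucker sum along that row is
the entry `U n t j` times a factor independent of `t`. -/
theorem tucker_sum_update_eq_mul {d : ℕ} {I J : Fin d → ℕ}
    (S : (∀ n : Fin d, Fin (J n)) → ℝ)
    (U : ∀ n : Fin d, Matrix (Fin (I n)) (Fin (J n)) ℝ)
    {n : Fin d} {j : Fin (J n)} {t : Fin (I n)} (ht : ∀ j', j' ≠ j → U n t j' = 0)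
    (idx : ∀ m : Fin d, Fin (I m)) :
    ∑ jdx : ∀ n : Fin d, Fin (J n), S jdx * ∏ m, U m (Function.update idx n t m) (jdx m) =
      U n t j * ∑ jdx : ∀ n : Fin d, Fin (J n),
        if jdx n = j then S jdx * ∏ m ∈ Finset.univ.erase n, U m (idx m) (jdx m) else 0 := by
  rw [Finset.mul_sum]
  refine Finset.sum_congr rfl fun jdx _ => ?_
  rw [← Finset.mul_prod_erase Finset.univ _ (Finset.mem_univ n), Function.update_self]
  split_ifs with h
  · rw [h, Finset.prod_congr rfl fun m hm => by
      rw [Function.update_of_ne (Finset.ne_of_mem_erase hm)]]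
    ring
  · simp [ht _ h]

/-- The entries of the factor matrices of a nonnegative orthogonal Tucker decomposition
are given explicitly by normalized ratios of entries of the tensor. -/
theorem tucker_factor_entries_from_ratios
    (d : ℕ) (I J : Fin d → ℕ)
    (A : (∀ n : Fin d, Fin (I n)) → ℝ)
    (S : (∀ n : Fin d, Fin (J n)) → ℝ)
    (U : ∀ n : Fin d, Matrix (Fin (I n)) (Fin (J n)) ℝ)
    (hSnonneg : ∀ jdx, 0 ≤ S jdx)
    (hUnonneg : ∀ n i j, 0 ≤ U n i j)
    (horth : ∀ n, (U n)ᵀ * U n = 1)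
    (hA : ∀ idx : ∀ n : Fin d, Fin (I n),
      A idx = ∑ jdx : ∀ n : Fin d, Fin (J n), S jdx * ∏ n, U n (idx n) (jdx n))
    (n : Fin d) (j : Fin (J n)) (t₀ : Fin (I n))
    (ht₀ : U n t₀ j ≠ 0)
    (idx : ∀ m : Fin d, Fin (I m))
    (hAne : A (Function.update idx n t₀) ≠ 0)
    (α : Fin (I n) → ℝ)
    (hα : ∀ t, α t = A (Function.update idx n t) / A (Function.update idx n t₀)) :
    ∀ t : Fin (I n), U n t j ≠ 0 →
      U n t j = α t / Real.sqrt (∑ t' ∈ Finset.univ.filter (fun t' => U n t' j ≠ 0), (α t') ^ 2) := by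
  obtain ⟨C, hC⟩ : ∃ C : ℝ, ∀ t, U n t j ≠ 0 → A (Function.update idx n t) = U n t j * C :=
    ⟨_, fun t ht => (hA _).trans (tucker_sum_update_eq_mul S U (fun _ hj =>
      eq_zero_of_nonneg_of_transpose_mul_self_eq_one (hUnonneg n) (horth n) ht hj) idx)⟩
  have hC0 : C ≠ 0 := fun h => hAne (by rw [hC t₀ ht₀, h, mul_zero])
  have hratio : ∀ t, U n t j ≠ 0 → α t = U n t j / U n t₀ j := fun t ht => by
    rw [hα, hC t ht, hC t₀ ht₀, mul_div_mul_right _ _ hC0]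
  have hsum : ∑ t ∈ Finset.univ.filter (fun t => U n t j ≠ 0), α t ^ 2 = (U n t₀ j)⁻¹ ^ 2 := by
    rw [Finset.sum_congr rfl fun t ht => by
      rw [hratio t (Finset.mem_filter.mp ht).2, div_eq_mul_inv, mul_pow],
      ← Finset.sum_mul, sum_sq_support_eq_one (horth n), one_mul]
  intro t ht
  rw [hsum, Real.sqrt_sq (inv_nonneg.mpr (hUnonneg n t₀ j)), hratio t ht]
  field_simp
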